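/- Let E be an arc set with (V,E) acyclic. Then the worst-case makespan Q_Γ(E) equals the minimum of z_t over all schedules z of (V,E,p) such that the singleton {t} is anchored with respect to z (for the budgeted uncertainty set Δ), and this minimum is attained. -/

import Mathlib

/-- `x` is a schedule of the precedence graph `(V, E, p)`. -/
def Schedule {V : Type*} (E : Set (V × V)) (p : V → ℝ) (x : V → ℝ) : Prop :=
  (∀ i, 0 ≤ x i) ∧ ∀ i j : V, (i, j) ∈ E → p i ≤ x j - x i

/-- `(α, E)` is acyclic: there is no closed walk of positive length along arcs of `E`. -/
def Acyclic {α : Type*} (E : Set (α × α)) : Prop :=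
  ¬ ∃ (m : ℕ) (v : ℕ → α), 1 ≤ m ∧ v 0 = v m ∧ ∀ ℓ < m, (v ℓ, v (ℓ + 1)) ∈ E

/-- `δ` belongs to the budgeted uncertainty set with deviations `δhat` and budget `Γ`. -/
def InBudget {V : Type*} [DecidableEq V] (J : Finset V) (δhat : V → ℝ) (Γ : ℕ)
    (δ : V → ℝ) : Prop :=
  ∃ S : Finset V, S ⊆ J ∧ S.card ≤ Γ ∧ (∀ i ∈ S, δ i = δhat i) ∧ ∀ i, i ∉ S → δ i = 0

/-- `H` is anchored with respect to the schedule `z` for arc set `E` and the budgeted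
uncertainty set. -/
def Anchored {V : Type*} [DecidableEq V] (J : Finset V) (δhat : V → ℝ) (Γ : ℕ)
    (E : Set (V × V)) (p : V → ℝ) (z : V → ℝ) (H : Set V) : Prop :=
  ∀ δ : V → ℝ, InBudget J δhat Γ δ →
    ∃ zd : V → ℝ, Schedule E (fun i => p i + δ i) zd ∧ ∀ i ∈ H, zd i = z i

/-- The set of makespans `x t` of schedules of `(V, E, p)`. -/
def MakespanSet {V : Type*} (E : Set (V × V)) (p : V → ℝ) (t : V) : Set ℝ :=
  { c | ∃ x : V → ℝ, Schedule E p x ∧ x t = c }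

/-- The set of inner minima `min { x t : x schedule of (V,E,p+δ) }` over budgeted `δ`;
the worst-case makespan `Q_Γ(E)` is its greatest element. -/
def WorstCaseSet {V : Type*} [DecidableEq V] (J : Finset V) (δhat : V → ℝ) (Γ : ℕ)
    (E : Set (V × V)) (p : V → ℝ) (t : V) : Set ℝ :=
  { m | ∃ δ : V → ℝ, InBudget J δhat Γ δ ∧
      IsLeast (MakespanSet E (fun i => p i + δ i) t) m }

theorem exists_walk_of_transGen {α : Type*} {E : Set (α × α)} {a b : α}
    (h : Relation.TransGen (fun i j => (i, j) ∈ E) a b) :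
    ∃ (m : ℕ) (v : ℕ → α), 1 ≤ m ∧ v 0 = a ∧ v m = b ∧ ∀ ℓ < m, (v ℓ, v (ℓ + 1)) ∈ E := by
  induction h using Relation.TransGen.head_induction_on with
  | @single a h =>
    refine ⟨1, fun n => Nat.casesOn n a fun _ => b, le_rfl, rfl, rfl, fun ℓ hℓ => ?_⟩
    obtain rfl : ℓ = 0 := by omega
    exact h
  | @head a c h _ ih =>
    obtain ⟨m, v, -, h0, hb, hv⟩ := ih
    refine ⟨m + 1, fun n => Nat.casesOn n a v, by omega, rfl, hb, fun ℓ hℓ => ?_⟩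
    cases ℓ with
    | zero => simpa [h0] using h
    | succ k => exact hv k (by omega)

theorem Acyclic.not_transGen_self {α : Type*} {E : Set (α × α)} (hE : Acyclic E) (a : α) :
    ¬ Relation.TransGen (fun i j => (i, j) ∈ E) a a := fun h => by
  obtain ⟨m, v, hm, h0, h1, hv⟩ := exists_walk_of_transGen h
  exact hE ⟨m, v, hm, h0.trans h1.symm, hv⟩

/-- Starting each job after the total processing time of its predecessors gives a schedule. -/
theorem Acyclic.exists_schedule {V : Type*} [Fintype V] {E : Set (V × V)} (hE : Acyclic E)
    {q : V → ℝ} (hq : ∀ i, 0 ≤ q i) : ∃ x, Schedule E q x := by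
  classical
  refine ⟨fun j => ∑ i with Relation.TransGen (fun i j => (i, j) ∈ E) i j, q i,
    fun j => Finset.sum_nonneg fun i _ => hq i, fun i j hij => ?_⟩
  have hi : i ∉ Finset.univ.filter
      (fun k => Relation.TransGen (fun i j => (i, j) ∈ E) k i) := by
    simpa using hE.not_transGen_self i
  rw [le_sub_iff_add_le, ← Finset.sum_insert hi]
  refine Finset.sum_le_sum_of_subset_of_nonneg (fun k hk => ?_) fun k _ _ => hq k
  rw [Finset.mem_insert, Finset.mem_filter] at hk
  rw [Finset.mem_filter]
  refine ⟨Finset.mem_univ k, ?_⟩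
  rcases hk with rfl | hk
  · exact .single hij
  · exact hk.2.tail hij

/-- The pointwise infimum of all schedules is a schedule, so the minimum makespan is attained. -/
theorem Acyclic.exists_isLeast_makespanSet {V : Type*} [Fintype V] {E : Set (V × V)}
    (hE : Acyclic E) {q : V → ℝ} (hq : ∀ i, 0 ≤ q i) (t : V) :
    ∃ c, IsLeast (MakespanSet E q t) c := by
  have hne : Nonempty {x // Schedule E q x} := nonempty_subtype.2 (hE.exists_schedule hq)
  have hbdd (i : V) : BddBelow (Set.range fun y : {x // Schedule E q x} => y.1 i) :=
    ⟨0, by rintro _ ⟨y, rfl⟩; exact y.2.1 i⟩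
  refine ⟨_, ⟨fun i => ⨅ y : {x // Schedule E q x}, y.1 i,
    ⟨fun i => le_ciInf fun y => y.2.1 i, fun i j hij => ?_⟩, rfl⟩, ?_⟩
  · rw [le_sub_iff_add_le]
    refine le_ciInf fun y => ?_
    have h1 := y.2.2 i j hij
    have h2 := ciInf_le (hbdd i) y
    linarith
  · rintro _ ⟨x, hx, rfl⟩
    exact ciInf_le (hbdd t) ⟨x, hx⟩

theorem Schedule.mono {V : Type*} {E : Set (V × V)} {p q x : V → ℝ} (hpq : ∀ i, p i ≤ q i)
    (hx : Schedule E q x) : Schedule E p x :=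
  ⟨hx.1, fun i j hij => (hpq i).trans (hx.2 i j hij)⟩

theorem Schedule.add_const {V : Type*} {E : Set (V × V)} {q x : V → ℝ} (hx : Schedule E q x)
    {a : ℝ} (ha : 0 ≤ a) : Schedule E q (fun i => x i + a) :=
  ⟨fun i => add_nonneg (hx.1 i) ha, fun i j hij => by
    rw [add_sub_add_right_eq_sub]
    exact hx.2 i j hij⟩

theorem InBudget.nonneg {V : Type*} [DecidableEq V] {J : Finset V} {δhat δ : V → ℝ} {Γ : ℕ}
    (h : InBudget J δhat Γ δ) (hδhat : ∀ i, 0 ≤ δhat i) (i : V) : 0 ≤ δ i := by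
  obtain ⟨S, -, -, hS, hS'⟩ := h
  by_cases hi : i ∈ S
  · exact (hδhat i).trans_eq (hS i hi).symm
  · exact (hS' i hi).ge

/-- For acyclic `(V, E)`, the worst-case makespan `Q_Γ(E)` equals the minimum makespan
`z t` over schedules `z` of `(V, E, p)` such that `{t}` is anchored w.r.t. `z`, and this
minimum is attained. -/
theorem worst_case_makespan_eq_min_anchored_t {V : Type*} [Fintype V] [DecidableEq V]
    (J : Finset V) (s t : V) (hst : s ≠ t) (hsJ : s ∉ J) (htJ : t ∉ J)
    (hV : ∀ v : V, v ∈ J ∨ v = s ∨ v = t)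
    (p : V → ℝ) (hp : ∀ i, 0 ≤ p i) (hps : p s = 0) (hpt : p t = 0)
    (δhat : V → ℝ) (hδhat : ∀ i, 0 ≤ δhat i) (hδs : δhat s = 0) (hδt : δhat t = 0)
    (Γ : ℕ)
    (E : Set (V × V)) (hE : Acyclic E)
    (Q : ℝ) (hQ : IsGreatest (WorstCaseSet J δhat Γ E p t) Q) :
    IsLeast { c : ℝ | ∃ z : V → ℝ, Schedule E p z ∧
        Anchored J δhat Γ E p z {t} ∧ z t = c } Q := by
  obtain ⟨⟨δ₀, hδ₀, ⟨z, hz, rfl⟩, hmin⟩, hmax⟩ := hQ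
  constructor
  · refine ⟨z, hz.mono fun i => le_add_of_nonneg_right (hδ₀.nonneg hδhat i), fun δ hδ => ?_, rfl⟩
    obtain ⟨c, hc⟩ := hE.exists_isLeast_makespanSet
      (fun i => add_nonneg (hp i) (hδ.nonneg hδhat i)) t
    have hcz : c ≤ z t := hmax ⟨δ, hδ, hc⟩
    obtain ⟨⟨x, hx, rfl⟩, -⟩ := hc
    refine ⟨_, hx.add_const (sub_nonneg.2 hcz), ?_⟩
    rintro i rfl
    exact add_sub_cancel _ _
  · rintro _ ⟨y, -, hy, rfl⟩
    obtain ⟨x, hx, hxt⟩ := hy δ₀ hδ₀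
    exact hmin ⟨x, hx, hxt t rfl⟩
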